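/- Let L/E be a finite Galois extension of fields with k ⊆ E ⊆ L ⊆ k̄, and let G = Gal(L/E). Then μ(L) is stable under G (each σ ∈ G commutes with every C_a, a ∈ F_q[T]), and the map φ : Drincog(L/E) → Z¹(G, μ(L)) given by φ(u + E) = f_u, where f_u(σ) = σ(u) − u, is a well-defined group isomorphism onto the group of 1-cocycles (crossed homomorphisms f : G → μ(L), f(στ) = f(σ) + σ·f(τ)). -/

import Mathlib

open Polynomial IntermediateField

noncomputable section

variable (Fq : Type) [Field Fq] [Fintype Fq]

/-- A fixed algebraic closure of the rational function field `k = Fq(T)`. -/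
abbrev Kbar := AlgebraicClosure (RatFunc Fq)

/-- The Carlitz action of `T`: the `Fq`-linear map `u ↦ T•u + u^q`. -/
def carlitzT : Module.End Fq (Kbar Fq) where
  toFun u := algebraMap (RatFunc Fq) (Kbar Fq) RatFunc.X * u + u ^ Fintype.card Fq
  map_add' u v := by
    obtain ⟨n, hp, hcard⟩ := FiniteField.card Fq (ringChar Fq)
    haveI : Fact (ringChar Fq).Prime := ⟨hp⟩
    haveI : CharP (Kbar Fq) (ringChar Fq) :=
      charP_of_injective_algebraMap (algebraMap Fq (Kbar Fq)).injective _
    show algebraMap (RatFunc Fq) (Kbar Fq) RatFunc.X * (u + v) + (u + v) ^ Fintype.card Fq =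
      (algebraMap (RatFunc Fq) (Kbar Fq) RatFunc.X * u + u ^ Fintype.card Fq) +
        (algebraMap (RatFunc Fq) (Kbar Fq) RatFunc.X * v + v ^ Fintype.card Fq)
    rw [hcard, add_pow_char_pow]
    ring
  map_smul' c u := by
    simp only [RingHom.id_apply, smul_add, mul_smul_comm, _root_.smul_pow, FiniteField.pow_card]

/-- The Carlitz module: the `Fq`-algebra morphism `Fq[T] → End_{Fq}(k̄)`
determined by `T ↦ (u ↦ T·u + u^q)`. -/
def carlitzHom : Polynomial Fq →ₐ[Fq] Module.End Fq (Kbar Fq) :=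
  aeval (carlitzT Fq)

/-- The Carlitz action `C_a(u)`. -/
def carlitz (a : Polynomial Fq) (u : Kbar Fq) : Kbar Fq :=
  carlitzHom Fq a u

/-- `Λ_a = {u ∈ k̄ : C_a(u) = 0}`. -/
def Lambda (a : Polynomial Fq) : Set (Kbar Fq) := {u | carlitz Fq a u = 0}

/-- The Carlitz torsion `μ(L)` of an intermediate field `L`. -/
def carlitzTorsion (L : IntermediateField (RatFunc Fq) (Kbar Fq)) : Set (Kbar Fq) :=
  {u | u ∈ L ∧ ∃ a : Polynomial Fq, a ≠ 0 ∧ carlitz Fq a u = 0}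

/-- `DrinT(L/K) = {u ∈ L : C_m(u) ∈ K for some nonzero m}`. -/
def DrinT (K L : IntermediateField (RatFunc Fq) (Kbar Fq)) : Set (Kbar Fq) :=
  {u | u ∈ L ∧ ∃ m : Polynomial Fq, m ≠ 0 ∧ carlitz Fq m u ∈ K}

/-- `L/K` is radical: `L = K(X)` for some `X ⊆ DrinT(L/K)`. -/
def IsRadicalC (K L : IntermediateField (RatFunc Fq) (Kbar Fq)) : Prop :=
  ∃ X ⊆ DrinT Fq K L, L = adjoin (RatFunc Fq) ((K : Set (Kbar Fq)) ∪ X)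

/-- `L/K` is pure: every root in `L` of some `C_m`, `m` irreducible, lies in `K`. -/
def IsPureC (K L : IntermediateField (RatFunc Fq) (Kbar Fq)) : Prop :=
  ∀ m : Polynomial Fq, Irreducible m → ∀ u ∈ L, carlitz Fq m u = 0 → u ∈ K

/-- `L/K` is separable: every element of `L` is separable over `K`. -/
def IsSeparableC (K L : IntermediateField (RatFunc Fq) (Kbar Fq)) : Prop :=
  ∀ u ∈ L, IsSeparable K u

/-- `L/K` is cyclotomic coradical: radical, separable and pure. -/
def IsCycloCoradicalC (K L : IntermediateField (RatFunc Fq) (Kbar Fq)) : Prop :=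
  IsRadicalC Fq K L ∧ IsSeparableC Fq K L ∧ IsPureC Fq K L


set_option synthInstance.maxHeartbeats 1000000

theorem carlitz_X (u : Kbar Fq) :
    carlitz Fq X u =
      algebraMap (RatFunc Fq) (Kbar Fq) RatFunc.X * u + u ^ Fintype.card Fq := by
  rw [carlitz, carlitzHom, aeval_X]
  rfl

theorem carlitz_C (c : Fq) (u : Kbar Fq) :
    carlitz Fq (C c) u = algebraMap (RatFunc Fq) (Kbar Fq) (algebraMap Fq (RatFunc Fq) c) * u := by
  rw [carlitz, carlitzHom, aeval_C, Module.algebraMap_end_apply, Algebra.smul_def,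
    IsScalarTower.algebraMap_apply Fq (RatFunc Fq) (Kbar Fq)]

theorem carlitz_mul (a b : Polynomial Fq) (u : Kbar Fq) :
    carlitz Fq (a * b) u = carlitz Fq a (carlitz Fq b u) := by
  simp only [carlitz, map_mul, Module.End.mul_apply]

theorem carlitz_add (a b : Polynomial Fq) (u : Kbar Fq) :
    carlitz Fq (a + b) u = carlitz Fq a u + carlitz Fq b u := by
  simp only [carlitz, map_add, LinearMap.add_apply]

theorem carlitz_sub_right (a : Polynomial Fq) (u v : Kbar Fq) :
    carlitz Fq a (u - v) = carlitz Fq a u - carlitz Fq a v :=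
  map_sub (carlitzHom Fq a) u v

theorem carlitz_eq_zero_of_dvd {a b : Polynomial Fq} (hab : a ∣ b) {u : Kbar Fq}
    (hu : carlitz Fq a u = 0) : carlitz Fq b u = 0 := by
  obtain ⟨c, rfl⟩ := hab
  rw [mul_comm, carlitz_mul, hu]
  exact map_zero (carlitzHom Fq c)

/-- The Carlitz action preserves every intermediate field of `k̄/k` and commutes with every
`k`-algebra map between such fields. -/
theorem exists_carlitz_eq {L M : IntermediateField (RatFunc Fq) (Kbar Fq)}
    (σ : L →ₐ[RatFunc Fq] M) (a : Polynomial Fq) (u : L) :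
    ∃ v : L, (v : Kbar Fq) = carlitz Fq a u ∧ (σ v : Kbar Fq) = carlitz Fq a (σ u) := by
  have mul_left {a b : Polynomial Fq}
      (ha : ∀ u : L, ∃ v : L, (v : Kbar Fq) = carlitz Fq a u ∧
        (σ v : Kbar Fq) = carlitz Fq a (σ u))
      (hb : ∀ u : L, ∃ v : L, (v : Kbar Fq) = carlitz Fq b u ∧
        (σ v : Kbar Fq) = carlitz Fq b (σ u)) (u : L) :
      ∃ v : L, (v : Kbar Fq) = carlitz Fq (a * b) u ∧
        (σ v : Kbar Fq) = carlitz Fq (a * b) (σ u) := by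
    obtain ⟨v, hv, hσv⟩ := hb u
    obtain ⟨w, hw, hσw⟩ := ha v
    exact ⟨w, by rw [hw, hv, carlitz_mul], by rw [hσw, hσv, carlitz_mul]⟩
  have const (c : Fq) (u : L) : ∃ v : L, (v : Kbar Fq) = carlitz Fq (C c) u ∧
      (σ v : Kbar Fq) = carlitz Fq (C c) (σ u) :=
    ⟨algebraMap (RatFunc Fq) L (algebraMap Fq (RatFunc Fq) c) * u, by rw [carlitz_C]; rfl,
      by rw [carlitz_C, map_mul, AlgHom.commutes]; rfl⟩
  have var (u : L) : ∃ v : L, (v : Kbar Fq) = carlitz Fq X u ∧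
      (σ v : Kbar Fq) = carlitz Fq X (σ u) :=
    ⟨algebraMap (RatFunc Fq) L RatFunc.X * u + u ^ Fintype.card Fq, by rw [carlitz_X]; rfl,
      by rw [carlitz_X, map_add, map_mul, map_pow, AlgHom.commutes]; rfl⟩
  induction a using Polynomial.induction_on generalizing u with
  | C c => exact const c u
  | add a b ha hb =>
    obtain ⟨v, hv, hσv⟩ := ha u
    obtain ⟨w, hw, hσw⟩ := hb u
    refine ⟨v + w, ?_, ?_⟩
    · rw [carlitz_add, ← hv, ← hw]; rfl
    · rw [carlitz_add, ← hσv, ← hσw, map_add]; rfl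
  | monomial n c ih =>
    rw [pow_succ, ← mul_assoc]
    exact mul_left ih var u

/-- Additive Hilbert 90: every additive 1-cocycle of a finite Galois extension is a coboundary. -/
theorem exists_eq_sub_of_cocycle {K F : Type*} [Field K] [Field F] [Algebra K F]
    [FiniteDimensional K F] [IsGalois K F] (f : (F ≃ₐ[K] F) → F)
    (hf : ∀ σ τ, f (σ * τ) = f σ + σ (f τ)) : ∃ u : F, ∀ σ, f σ = σ u - u := by
  obtain ⟨z, hz⟩ := Algebra.trace_surjective K F 1
  have hsum : ∑ τ : F ≃ₐ[K] F, τ z = 1 := by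
    rw [← trace_eq_sum_automorphisms, hz, map_one]
  refine ⟨-∑ τ : F ≃ₐ[K] F, f τ * τ z, fun σ ↦ ?_⟩
  have key : ∑ τ : F ≃ₐ[K] F, f τ * τ z = f σ + σ (∑ τ : F ≃ₐ[K] F, f τ * τ z) := by
    calc ∑ τ : F ≃ₐ[K] F, f τ * τ z = ∑ τ : F ≃ₐ[K] F, f (σ * τ) * (σ * τ) z :=
          (Equiv.sum_comp (Equiv.mulLeft σ) fun τ ↦ f τ * τ z).symm
      _ = f σ * ∑ τ : F ≃ₐ[K] F, (σ * τ) z + σ (∑ τ : F ≃ₐ[K] F, f τ * τ z) := by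
          simp only [hf, add_mul, Finset.sum_add_distrib, Finset.mul_sum, map_sum, map_mul,
            AlgEquiv.mul_apply]
      _ = _ := by
          rw [show ∑ τ : F ≃ₐ[K] F, (σ * τ) z = 1 from
            (Equiv.sum_comp (Equiv.mulLeft σ) fun τ : F ≃ₐ[K] F ↦ τ z).trans hsum, mul_one]
  rw [map_neg]
  linear_combination -key

/-- For `L/E` Galois, an element of `L` lies in `E` exactly when it is fixed by `Gal(L/E)`. -/
theorem coe_mem_iff_fixed {k K : Type*} [Field k] [Field K] [Algebra k K]
    {E L : IntermediateField k K} (hEL : E ≤ L)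
    [FiniteDimensional E (extendScalars hEL)] [IsGalois E (extendScalars hEL)]
    (u : extendScalars hEL) :
    (u : K) ∈ E ↔ ∀ σ : extendScalars hEL ≃ₐ[E] extendScalars hEL, σ u = u := by
  rw [← IsGalois.mem_bot_iff_fixed, IntermediateField.mem_bot]
  constructor
  · intro h
    exact ⟨⟨u, h⟩, rfl⟩
  · rintro ⟨e, rfl⟩
    exact e.2

/-- Let `L/E` be a finite Galois extension (with `k ⊆ E ⊆ L ⊆ k̄`) and
`G = Gal(L/E)`.  Then `μ(L)` is stable under `G` (every `σ ∈ G` commutes with every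
`C_a`), and the map `φ : Drincog(L/E) → Z¹(G, μ(L))`, `φ(u + E) = f_u` with
`f_u(σ) = σ(u) - u`, is a well-defined group isomorphism onto the group of 1-cocycles:
`f_u` is a `μ(L)`-valued cocycle for every `u ∈ DrinT(L/E)`, `φ` is additive,
`f_u = f_v` precisely when `u - v ∈ E`, and every `μ(L)`-valued cocycle is `f_u` for
some `u ∈ DrinT(L/E)`. -/
theorem drincog_iso_cocycles (E L : IntermediateField (RatFunc Fq) (Kbar Fq))
    (hEL : E ≤ L) (hfin : FiniteDimensional E (extendScalars hEL))
    (hgal : IsGalois E (extendScalars hEL)) :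
    -- μ(L) is a G-module: every σ ∈ G commutes with every C_a
    (∀ (σ : extendScalars hEL ≃ₐ[E] extendScalars hEL) (a : Polynomial Fq)
        (u v : extendScalars hEL), (v : Kbar Fq) = carlitz Fq a (u : Kbar Fq) →
        ((σ v : Kbar Fq) = carlitz Fq a ((σ u : Kbar Fq)))) ∧
    -- for u ∈ DrinT(L/E), f_u = (σ ↦ σ(u) - u) is a 1-cocycle with values in μ(L)
    (∀ u : extendScalars hEL, (u : Kbar Fq) ∈ DrinT Fq E L →
      (∀ σ : extendScalars hEL ≃ₐ[E] extendScalars hEL,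
        ∃ a : Polynomial Fq, a ≠ 0 ∧ carlitz Fq a ((σ u - u : extendScalars hEL) : Kbar Fq) = 0) ∧
      (∀ σ τ : extendScalars hEL ≃ₐ[E] extendScalars hEL,
        (σ * τ) u - u = (σ u - u) + σ (τ u - u))) ∧
    -- φ is additive
    (∀ u v : extendScalars hEL, ∀ σ : extendScalars hEL ≃ₐ[E] extendScalars hEL,
      σ (u + v) - (u + v) = (σ u - u) + (σ v - v)) ∧
    -- φ is well defined and injective: f_u = f_v iff u - v ∈ E
    (∀ u v : extendScalars hEL, (u : Kbar Fq) ∈ DrinT Fq E L →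
      (v : Kbar Fq) ∈ DrinT Fq E L →
      ((∀ σ : extendScalars hEL ≃ₐ[E] extendScalars hEL, σ u - u = σ v - v) ↔
        ((u - v : extendScalars hEL) : Kbar Fq) ∈ E)) ∧
    -- φ is surjective onto the 1-cocycles with values in μ(L)
    (∀ f : (extendScalars hEL ≃ₐ[E] extendScalars hEL) → extendScalars hEL,
      (∀ σ, ∃ a : Polynomial Fq, a ≠ 0 ∧ carlitz Fq a ((f σ : Kbar Fq)) = 0) →
      (∀ σ τ, f (σ * τ) = f σ + σ (f τ)) →
      ∃ u : extendScalars hEL, (u : Kbar Fq) ∈ DrinT Fq E L ∧ ∀ σ, f σ = σ u - u) := by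
  have comm (σ : extendScalars hEL ≃ₐ[E] extendScalars hEL) (a : Polynomial Fq)
      (u : extendScalars hEL) : ∃ v : extendScalars hEL, (v : Kbar Fq) = carlitz Fq a u ∧
        (σ v : Kbar Fq) = carlitz Fq a (σ u) :=
    exists_carlitz_eq Fq (L := L) (M := L)
      { (σ : extendScalars hEL →+* extendScalars hEL) with
        commutes' := fun r ↦ σ.commutes (algebraMap (RatFunc Fq) E r) } a u
  refine ⟨?_, ?_, ?_, ?_, ?_⟩
  · intro σ a u v hv
    obtain ⟨w, hw, hσw⟩ := comm σ a u
    rwa [Subtype.ext (hv.trans hw.symm)]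
  · rintro u ⟨-, m, hm, hmu⟩
    refine ⟨fun σ ↦ ⟨m, hm, ?_⟩, fun σ τ ↦ ?_⟩
    · obtain ⟨w, hw, hσw⟩ := comm σ m u
      rw [← hw, coe_mem_iff_fixed hEL] at hmu
      rw [AddSubgroupClass.coe_sub, carlitz_sub_right, ← hσw, hmu σ, hw, sub_self]
    · rw [AlgEquiv.mul_apply, map_sub]
      ring
  · intro u v σ
    rw [map_add]
    ring
  · intro u v _ _
    rw [coe_mem_iff_fixed hEL]
    refine forall_congr' fun σ ↦ ?_
    rw [map_sub, sub_eq_sub_iff_sub_eq_sub]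
  · intro f hμ hf
    obtain ⟨u, hu⟩ := exists_eq_sub_of_cocycle f hf
    choose a ha hfa using hμ
    refine ⟨u, ⟨u.2, ∏ σ, a σ, Finset.prod_ne_zero_iff.2 fun σ _ ↦ ha σ, ?_⟩, hu⟩
    obtain ⟨w, hw, -⟩ := comm 1 (∏ σ, a σ) u
    rw [← hw, coe_mem_iff_fixed hEL]
    intro σ
    obtain ⟨v, hv, hσv⟩ := comm σ (∏ σ, a σ) u
    obtain rfl : v = w := Subtype.ext (hv.trans hw.symm)
    have hzero := carlitz_eq_zero_of_dvd Fq (Finset.dvd_prod_of_mem a (Finset.mem_univ σ)) (hfa σ)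
    rw [hu, AddSubgroupClass.coe_sub, carlitz_sub_right, ← hσv, ← hv] at hzero
    exact Subtype.ext (sub_eq_zero.1 hzero)

end
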